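/- There exists no 4×4 positive semidefinite complex matrix ρ of trace 1 (indexed by (Fin 2)×(Fin 2)) satisfying simultaneously trace(ρ · (σz ⊗ σz)) = −1, trace(ρ · (σx ⊗ σx)) = −1, and trace(ρ · (σy ⊗ σy)) = +1. -/

import Mathlib

open Matrix Kronecker
open scoped ComplexOrder

noncomputable section

/-- The Pauli matrix σx. -/
def sigmaX : Matrix (Fin 2) (Fin 2) ℂ := !![0, 1; 1, 0]
/-- The Pauli matrix σy. -/
def sigmaY : Matrix (Fin 2) (Fin 2) ℂ := !![0, -Complex.I; Complex.I, 0]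
/-- The Pauli matrix σz. -/
def sigmaZ : Matrix (Fin 2) (Fin 2) ℂ := !![1, 0; 0, -1]

/-- The quadratic form of `ρ` at the unnormalised Bell vector `e₀₀ + e₁₁`, written in terms of the
trace of `ρ` and its Pauli correlations. -/
theorem two_mul_star_bell_dotProduct_mulVec (ρ : Matrix (Fin 2 × Fin 2) (Fin 2 × Fin 2) ℂ) :
    2 * (star (fun p : Fin 2 × Fin 2 => if p.1 = p.2 then (1 : ℂ) else 0) ⬝ᵥ
        ρ *ᵥ fun p => if p.1 = p.2 then 1 else 0) =
      ρ.trace + (ρ * (sigmaZ ⊗ₖ sigmaZ)).trace + (ρ * (sigmaX ⊗ₖ sigmaX)).trace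
        - (ρ * (sigmaY ⊗ₖ sigmaY)).trace := by
  simp [Matrix.trace, Matrix.mul_apply, dotProduct, Matrix.mulVec, Fintype.sum_prod_type,
    sigmaX, sigmaY, sigmaZ]
  ring

theorem no_quantum_state_anticorrelated_in_z_x_and_correlated_in_y :
    ¬ ∃ ρ : Matrix (Fin 2 × Fin 2) (Fin 2 × Fin 2) ℂ,
      ρ.PosSemidef ∧ ρ.trace = 1 ∧
      (ρ * (sigmaZ ⊗ₖ sigmaZ)).trace = -1 ∧
      (ρ * (sigmaX ⊗ₖ sigmaX)).trace = -1 ∧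
      (ρ * (sigmaY ⊗ₖ sigmaY)).trace = 1 := by
  rintro ⟨ρ, hρ, htr, hz, hx, hy⟩
  have hnonneg := hρ.dotProduct_mulVec_nonneg
    (fun p : Fin 2 × Fin 2 => if p.1 = p.2 then (1 : ℂ) else 0)
  have hbell := two_mul_star_bell_dotProduct_mulVec ρ
  rw [htr, hz, hx, hy] at hbell
  have hre := congrArg Complex.re hbell
  have hre_nonneg := (Complex.le_def.1 hnonneg).1
  norm_num at hre hre_nonneg
  linarith
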